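/- Let H be a real Hilbert space, S ⊆ H a closed subspace, and P : H → H the orthogonal projection onto S. Let a < b be real numbers and u, u' : ℝ → H functions such that u' is Bochner integrable on [a,b], ‖u'(·)‖² is integrable on [a,b], and u(t) = u(a) + ∫_a^t u'(s) ds for all t ∈ [a,b]. Define the projected linear interpolant Ju(t) = ((b−t)·P(u(a)) + (t−a)·P(u(b)))/(b−a). Then ∫_a^b ‖u(t) − Ju(t)‖² dt ≤ 3·( (b−a)²·∫_a^b ‖u'(s)‖² ds + (b−a)·( ‖u(a) − P(u(a))‖² + ‖u(b) − P(u(b))‖² ) ). -/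

import Mathlib

open MeasureTheory intervalIntegral

/-- Cauchy–Schwarz on an interval, against the constant function `1`. -/
theorem sq_intervalIntegral_le_mul_intervalIntegral_sq {a b : ℝ} (hab : a < b) {g : ℝ → ℝ}
    (hg : IntervalIntegrable g volume a b)
    (hg2 : IntervalIntegrable (fun s => g s ^ 2) volume a b) :
    (∫ s in a..b, g s) ^ 2 ≤ (b - a) * ∫ s in a..b, g s ^ 2 := by
  have hba : 0 < b - a := sub_pos.2 hab
  set c : ℝ := (∫ s in a..b, g s) / (b - a) with hc
  have hM : ∫ s in a..b, g s = c * (b - a) := by rw [hc]; field_simp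
  have hnonneg : 0 ≤ ∫ s in a..b, (g s - c) ^ 2 :=
    intervalIntegral.integral_nonneg hab.le fun s _ => sq_nonneg _
  have hexpand : ∫ s in a..b, (g s - c) ^ 2 =
      (∫ s in a..b, g s ^ 2) - 2 * c * (∫ s in a..b, g s) + c ^ 2 * (b - a) := by
    have hfun : (fun s => (g s - c) ^ 2) = fun s => g s ^ 2 - 2 * c * g s + c ^ 2 := by
      funext s; ring
    rw [hfun, intervalIntegral.integral_add (hg2.sub (hg.const_mul _)) intervalIntegrable_const,
      intervalIntegral.integral_sub hg2 (hg.const_mul _), intervalIntegral.integral_const_mul,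
      intervalIntegral.integral_const, smul_eq_mul]
    ring
  rw [hexpand, hM] at hnonneg
  rw [hM]
  nlinarith [mul_nonneg hba.le hnonneg]

/-- The integral over a subinterval is bounded by the integral of the norm over the interval. -/
theorem norm_intervalIntegral_le_of_subinterval {E : Type*} [NormedAddCommGroup E]
    [NormedSpace ℝ E] {a b c d : ℝ} (hac : a ≤ c) (hcd : c ≤ d) (hdb : d ≤ b) {f : ℝ → E}
    (hf : IntervalIntegrable f volume a b) :
    ‖∫ s in c..d, f s‖ ≤ ∫ s in a..b, ‖f s‖ :=
  (intervalIntegral.norm_integral_le_integral_norm hcd).trans <|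
    intervalIntegral.integral_mono_interval hac hcd hdb
      (Filter.Eventually.of_forall fun _ => norm_nonneg _) hf.norm

/-- A pointwise bound for the error of a linear interpolant of perturbed nodal values. -/
theorem norm_sub_linear_interpolant_sq_le {E : Type*} [NormedAddCommGroup E] [NormedSpace ℝ E]
    {a b t M : ℝ} (hab : a < b) (ht : t ∈ Set.Icc a b) {x y z p q : E}
    (hx : ‖z - x‖ ≤ M) (hy : ‖z - y‖ ≤ M) :
    ‖z - (b - a)⁻¹ • ((b - t) • p + (t - a) • q)‖ ^ 2 ≤
      3 * (M ^ 2 + (‖x - p‖ ^ 2 + ‖y - q‖ ^ 2)) := by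
  have hba : 0 < b - a := sub_pos.2 hab
  obtain ⟨α, hα⟩ : ∃ α, α = (b - a)⁻¹ * (b - t) := ⟨_, rfl⟩
  obtain ⟨β, hβ⟩ : ∃ β, β = (b - a)⁻¹ * (t - a) := ⟨_, rfl⟩
  have hα0 : 0 ≤ α := hα ▸ mul_nonneg (inv_nonneg.2 hba.le) (sub_nonneg.2 ht.2)
  have hβ0 : 0 ≤ β := hβ ▸ mul_nonneg (inv_nonneg.2 hba.le) (sub_nonneg.2 ht.1)
  have hsum : α + β = 1 := by rw [hα, hβ]; field_simp; ring
  have hsplit : z - (b - a)⁻¹ • ((b - t) • p + (t - a) • q) =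
      α • (z - x) + β • (z - y) + α • (x - p) + β • (y - q) := by
    rw [smul_add, smul_smul, smul_smul, ← hα, ← hβ]
    obtain rfl : β = 1 - α := by linarith
    module
  have hnorm : ‖z - (b - a)⁻¹ • ((b - t) • p + (t - a) • q)‖ ≤ M + ‖x - p‖ + ‖y - q‖ := by
    rw [hsplit]
    refine norm_add₄_le.trans ?_
    simp only [norm_smul, Real.norm_eq_abs, abs_of_nonneg hα0, abs_of_nonneg hβ0]
    have hxy : α * ‖z - x‖ + β * ‖z - y‖ ≤ M :=
      calc α * ‖z - x‖ + β * ‖z - y‖ ≤ α * M + β * M := by gcongr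
        _ = M := by rw [← add_mul, hsum, one_mul]
    have hp : α * ‖x - p‖ ≤ ‖x - p‖ := mul_le_of_le_one_left (norm_nonneg _) (by linarith)
    have hq : β * ‖y - q‖ ≤ ‖y - q‖ := mul_le_of_le_one_left (norm_nonneg _) (by linarith)
    linarith
  refine (pow_le_pow_left₀ (norm_nonneg _) hnorm 2).trans ?_
  nlinarith [sq_nonneg (M - ‖x - p‖), sq_nonneg (M - ‖y - q‖), sq_nonneg (‖x - p‖ - ‖y - q‖)]

/-- Single-interval abstract form of the L² estimate of Theorem 4.3 (thm:tp) for
the projected linear interpolant `Ju(t) = ((b−t)·P(u a) + (t−a)·P(u b))/(b−a)`,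
where `P` is the orthogonal projection onto a closed subspace `S`. -/
theorem projected_linear_interpolant_L2_bound
    {H : Type*} [NormedAddCommGroup H] [InnerProductSpace ℝ H] [CompleteSpace H]
    (S : Submodule ℝ H) (hS : IsClosed (S : Set H))
    (P : H → H) (hPmem : ∀ x : H, P x ∈ S)
    (hPorth : ∀ x : H, ∀ y ∈ S, inner (𝕜 := ℝ) (x - P x) y = 0)
    (a b : ℝ) (hab : a < b) (u u' : ℝ → H)
    (hint : IntervalIntegrable u' volume a b)
    (hint2 : IntervalIntegrable (fun s => ‖u' s‖ ^ 2) volume a b)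
    (hu : ∀ t ∈ Set.Icc a b, u t = u a + ∫ s in a..t, u' s) :
    (∫ t in a..b, ‖u t - (b - a)⁻¹ • ((b - t) • P (u a) + (t - a) • P (u b))‖ ^ 2) ≤
      3 * ((b - a) ^ 2 * (∫ s in a..b, ‖u' s‖ ^ 2) +
        (b - a) * (‖u a - P (u a)‖ ^ 2 + ‖u b - P (u b)‖ ^ 2)) := by
  have hba : 0 < b - a := sub_pos.2 hab
  set M := ∫ s in a..b, ‖u' s‖ with hM
  have hpt : ∀ t ∈ Set.uIoc a b,
      ‖‖u t - (b - a)⁻¹ • ((b - t) • P (u a) + (t - a) • P (u b))‖ ^ 2‖ ≤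
        3 * (M ^ 2 + (‖u a - P (u a)‖ ^ 2 + ‖u b - P (u b)‖ ^ 2)) := by
    intro t ht
    rw [Set.uIoc_of_le hab.le] at ht
    have ht' : t ∈ Set.Icc a b := Set.Ioc_subset_Icc_self ht
    rw [Real.norm_of_nonneg (sq_nonneg _)]
    refine norm_sub_linear_interpolant_sq_le hab ht' ?_ ?_
    · rw [hu t ht', add_sub_cancel_left]
      exact norm_intervalIntegral_le_of_subinterval le_rfl ht'.1 ht'.2 hint
    · have hat : IntervalIntegrable u' volume a t :=
        hint.mono_set (Set.uIcc_subset_uIcc_left (Set.Icc_subset_uIcc ht'))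
      rw [norm_sub_rev, hu t ht', hu b (Set.right_mem_Icc.2 hab.le), add_sub_add_left_eq_sub,
        intervalIntegral.integral_interval_sub_left hint hat]
      exact norm_intervalIntegral_le_of_subinterval ht'.1 ht'.2 le_rfl hint
  have hCS : M ^ 2 ≤ (b - a) * ∫ s in a..b, ‖u' s‖ ^ 2 :=
    sq_intervalIntegral_le_mul_intervalIntegral_sq hab hint.norm hint2
  have hI := (le_abs_self _).trans (intervalIntegral.norm_integral_le_of_norm_le_const hpt)
  rw [abs_of_pos hba] at hI
  refine hI.trans ?_
  nlinarith [mul_le_mul_of_nonneg_left hCS hba.le]
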